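/- Let 𝓡 = {r₁,…,r_m} be a finite set of monic monomials on ℝ^d, let L : ℝ^m → ℝ, and define the loss H(μ) = L(ρ_{r₁}(μ),…,ρ_{r_m}(μ)) on the class 𝒜 of finite Borel measures μ on ℝ^d for which every r ∈ 𝓡 is μ-integrable. Suppose μ₁, μ₂ ∈ 𝒜 and ρ_r(μ₂) = 1 for every r ∈ 𝓡 (i.e., μ₂ has 1-set 𝓡). Then the multiplicative convolution μ₁ * μ₂ belongs to 𝒜 and ρ_r(μ₁ * μ₂) = ρ_r(μ₁) for every r ∈ 𝓡; consequently H(μ₁ * μ₂) = H(μ₁), and if μ₁ is a global minimizer of H over 𝒜, then so is μ₁ * μ₂. -/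

import Mathlib

open MeasureTheory

/-- Multiplicative convolution of two measures on `ℝ^d`: the pushforward of the
product measure under coordinatewise multiplication. -/
noncomputable def mconv {d : ℕ} (μ ν : Measure (Fin d → ℝ)) : Measure (Fin d → ℝ) :=
  (μ.prod ν).map (fun p : (Fin d → ℝ) × (Fin d → ℝ) => fun i => p.1 i * p.2 i)

/-- The monic monomial `r_I(z) = ∏_{i ∈ I} z_i` associated with an index set `I`. -/
def monomial {d : ℕ} (I : Finset (Fin d)) (z : Fin d → ℝ) : ℝ := ∏ i ∈ I, z i

/-- The monomial potential `ρ_{r_I}(μ) = ∫ r_I dμ`. -/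
noncomputable def pot {d : ℕ} (I : Finset (Fin d)) (μ : Measure (Fin d → ℝ)) : ℝ :=
  ∫ z, monomial I z ∂μ

theorem monomial_mul {d : ℕ} (I : Finset (Fin d)) (x y : Fin d → ℝ) :
    monomial I (fun i => x i * y i) = monomial I x * monomial I y :=
  Finset.prod_mul_distrib

theorem measurable_monomial {d : ℕ} (I : Finset (Fin d)) : Measurable (monomial I) :=
  Finset.measurable_fun_prod I fun i _ => measurable_pi_apply i

theorem measurable_coordinatewise_mul {d : ℕ} :
    Measurable (fun p : (Fin d → ℝ) × (Fin d → ℝ) => fun i => p.1 i * p.2 i) := by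
  fun_prop

instance isFiniteMeasure_mconv {d : ℕ} (μ ν : Measure (Fin d → ℝ)) [IsFiniteMeasure μ]
    [IsFiniteMeasure ν] : IsFiniteMeasure (mconv μ ν) := by
  unfold mconv
  infer_instance

theorem integrable_monomial_mconv {d : ℕ} {I : Finset (Fin d)} {μ ν : Measure (Fin d → ℝ)}
    [SFinite μ] [SFinite ν] (hμ : Integrable (monomial I) μ) (hν : Integrable (monomial I) ν) :
    Integrable (monomial I) (mconv μ ν) := by
  rw [mconv, integrable_map_measure (measurable_monomial I).aestronglyMeasurable
    measurable_coordinatewise_mul.aemeasurable]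
  simpa only [Function.comp_def, monomial_mul] using hμ.mul_prod hν

theorem pot_mconv {d : ℕ} (I : Finset (Fin d)) (μ ν : Measure (Fin d → ℝ))
    [SFinite μ] [SFinite ν] : pot I (mconv μ ν) = pot I μ * pot I ν := by
  rw [pot, mconv, integral_map measurable_coordinatewise_mul.aemeasurable
    (measurable_monomial I).aestronglyMeasurable]
  simp only [monomial_mul]
  exact integral_prod_mul _ _

/-- If `μ₂` has 1-set the whole monomial family `𝓡 = {r₁, …, r_m}`, then
convolving with `μ₂` preserves the class `𝒜` of admissible finite measures,
preserves every monomial potential, hence preserves the loss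
`H(μ) = L(ρ_{r₁}(μ), …, ρ_{r_m}(μ))`, and sends global minimizers of `H` over
`𝒜` to global minimizers. -/
theorem mconv_with_one_set_preserves_global_min {d m : ℕ}
    (r : Fin m → Finset (Fin d)) (L : (Fin m → ℝ) → ℝ)
    (μ₁ μ₂ : Measure (Fin d → ℝ)) [IsFiniteMeasure μ₁] [IsFiniteMeasure μ₂]
    (hint₁ : ∀ i, Integrable (monomial (r i)) μ₁)
    (hint₂ : ∀ i, Integrable (monomial (r i)) μ₂)
    (hone : ∀ i, pot (r i) μ₂ = 1) :
    IsFiniteMeasure (mconv μ₁ μ₂) ∧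
    (∀ i, Integrable (monomial (r i)) (mconv μ₁ μ₂)) ∧
    (∀ i, pot (r i) (mconv μ₁ μ₂) = pot (r i) μ₁) ∧
    L (fun i => pot (r i) (mconv μ₁ μ₂)) = L (fun i => pot (r i) μ₁) ∧
    ((∀ ν : Measure (Fin d → ℝ), IsFiniteMeasure ν →
        (∀ i, Integrable (monomial (r i)) ν) →
        L (fun i => pot (r i) μ₁) ≤ L (fun i => pot (r i) ν)) →
      (∀ ν : Measure (Fin d → ℝ), IsFiniteMeasure ν →
        (∀ i, Integrable (monomial (r i)) ν) →
        L (fun i => pot (r i) (mconv μ₁ μ₂)) ≤ L (fun i => pot (r i) ν))) := by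
  have hpot : ∀ i, pot (r i) (mconv μ₁ μ₂) = pot (r i) μ₁ := fun i => by
    rw [pot_mconv, hone, mul_one]
  refine ⟨inferInstance, fun i => integrable_monomial_mconv (hint₁ i) (hint₂ i), hpot, ?_, ?_⟩
  · simp only [hpot]
  · simp only [hpot]
    exact id
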